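/- Assume ℓ ≥ |s|, and define x_i := (1/i!)·((2ℓ−i)!/(2ℓ)!)·((ℓ−s)!·ℓ!·(ℓ+s)!)/((ℓ−s−i)!·(ℓ−i)!·(ℓ+s−i)!) for 0 ≤ i ≤ ℓ−|s|, and x_i := 0 for i > ℓ−|s|. Let α : U → ℝ be a smooth fixed-mode solution of the spin-s Teukolsky equation and set A := Σ_{i=0}^{ℓ−|s|} x_i · (2M)^i · ((r²/D)∂ᵥ)^(ℓ−s−i) α. Then, with c_N := (1+s)(1+2s) + 3N(N+1+2s), the following approximate conservation law holds pointwise on U: ∂ᵤ( (D/r²)^ℓ · ∂ᵥA ) = Σ_{k=0}^{ℓ−|s|} ( 2(k+1)·x_{k+1}·(2M/r)·(1 − 3M/r) − x_k·(2M/r)·c_{ℓ−s−k} ) · (D/r²)^(ℓ+1) · (2M)^k · ((r²/D)∂ᵥ)^(ℓ−s−k) α. In particular, every term on the right-hand side carries a factor 2M/r. (This is equation (8.14), the approximate conservation law satisfied by A^{[s]}_ℓ, in scalar fixed-angular-mode form.) -/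

import Mathlib

open scoped ContDiff

noncomputable section

/-- Partial derivative with respect to the first (`u`) null coordinate. -/
def pdu (f : ℝ × ℝ → ℝ) : ℝ × ℝ → ℝ := fun p => deriv (fun x => f (x, p.2)) p.1

/-- Partial derivative with respect to the second (`v`) null coordinate. -/
def pdv (f : ℝ × ℝ → ℝ) : ℝ × ℝ → ℝ := fun p => deriv (fun y => f (p.1, y)) p.2

/-- `D = 1 - 2M/r`. -/
def Dfun (M : ℝ) (r : ℝ × ℝ → ℝ) : ℝ × ℝ → ℝ := fun p => 1 - 2 * M / r p

/-- The weighted transversal derivative operator `(r²/D)∂ᵥ`. -/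
def Pv (M : ℝ) (r f : ℝ × ℝ → ℝ) : ℝ × ℝ → ℝ := fun p => (r p) ^ 2 / Dfun M r p * pdv f p

/-- Factorial of a (nonnegative) integer, as a real number. -/
def zfactR (n : ℤ) : ℝ := (Nat.factorial n.toNat : ℝ)

/-- `α` is a fixed-mode solution of the spin-`s` Teukolsky equation (Teuk:s) on `U`,
projected to spherical-harmonic number `ℓ`, i.e.
`∂ᵤ(r^(−2s) D^s ∂ᵥα) = D^(s+1) r^(−2−2s) Λ α − 2M D^(s+1) r^(−3−2s) (1+s)(1+2s) α`
with `Λ = −(ℓ−s)(ℓ+s+1)`. -/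
def TeukSol (M : ℝ) (r : ℝ × ℝ → ℝ) (U : Set (ℝ × ℝ)) (s ℓ : ℤ) (α : ℝ × ℝ → ℝ) : Prop :=
  ∀ p ∈ U,
    pdu (fun q => (r q) ^ (-(2 * s)) * (Dfun M r q) ^ s * pdv α q) p =
      (Dfun M r p) ^ (s + 1) * (r p) ^ (-2 - 2 * s) * ((-(ℓ - s) * (ℓ + s + 1) : ℤ) : ℝ) * α p
        - 2 * M * (Dfun M r p) ^ (s + 1) * (r p) ^ (-3 - 2 * s) *
          (((1 + s) * (1 + 2 * s) : ℤ) : ℝ) * α p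

section PartialDerivatives

variable {U : Set (ℝ × ℝ)} {f g : ℝ × ℝ → ℝ} {p : ℝ × ℝ}

lemma hasDerivAt_fderiv_fst (hf : DifferentiableAt ℝ f p) :
    HasDerivAt (fun x => f (x, p.2)) (fderiv ℝ f p (1, 0)) p.1 :=
  HasFDerivAt.comp_hasDerivAt (f := fun x : ℝ => (x, p.2)) p.1 hf.hasFDerivAt
    ((hasDerivAt_id p.1).prodMk (hasDerivAt_const p.1 p.2))

lemma hasDerivAt_fderiv_snd (hf : DifferentiableAt ℝ f p) :
    HasDerivAt (fun y => f (p.1, y)) (fderiv ℝ f p (0, 1)) p.2 :=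
  HasFDerivAt.comp_hasDerivAt (f := fun y : ℝ => (p.1, y)) p.2 hf.hasFDerivAt
    ((hasDerivAt_const p.2 p.1).prodMk (hasDerivAt_id p.2))

lemma pdu_eq_fderiv (hf : DifferentiableAt ℝ f p) : pdu f p = fderiv ℝ f p (1, 0) :=
  (hasDerivAt_fderiv_fst hf).deriv

lemma pdv_eq_fderiv (hf : DifferentiableAt ℝ f p) : pdv f p = fderiv ℝ f p (0, 1) :=
  (hasDerivAt_fderiv_snd hf).deriv

lemma hasDerivAt_pdu (hf : DifferentiableAt ℝ f p) :
    HasDerivAt (fun x => f (x, p.2)) (pdu f p) p.1 :=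
  pdu_eq_fderiv hf ▸ hasDerivAt_fderiv_fst hf

lemma hasDerivAt_pdv (hf : DifferentiableAt ℝ f p) :
    HasDerivAt (fun y => f (p.1, y)) (pdv f p) p.2 :=
  pdv_eq_fderiv hf ▸ hasDerivAt_fderiv_snd hf

lemma ContDiffOn.differentiableAt_of_isOpen (hU : IsOpen U) (hf : ContDiffOn ℝ ∞ f U)
    (hp : p ∈ U) : DifferentiableAt ℝ f p :=
  (hf.contDiffAt (hU.mem_nhds hp)).differentiableAt (by simp)

lemma pdu_congr (hU : IsOpen U) (hfg : ∀ q ∈ U, f q = g q) (hp : p ∈ U) :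
    pdu f p = pdu g p := by
  apply Filter.EventuallyEq.deriv_eq
  have hc : ContinuousAt (fun x : ℝ => (x, p.2)) p.1 := by fun_prop
  filter_upwards [hc (hU.mem_nhds hp)] with x hx using hfg _ hx

lemma pdv_congr (hU : IsOpen U) (hfg : ∀ q ∈ U, f q = g q) (hp : p ∈ U) :
    pdv f p = pdv g p := by
  apply Filter.EventuallyEq.deriv_eq
  have hc : ContinuousAt (fun y : ℝ => (p.1, y)) p.2 := by fun_prop
  filter_upwards [hc (hU.mem_nhds hp)] with x hx using hfg _ hx

lemma contDiffOn_fderiv_apply (hU : IsOpen U) (hf : ContDiffOn ℝ ∞ f U) (e : ℝ × ℝ) :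
    ContDiffOn ℝ ∞ (fun q => fderiv ℝ f q e) U :=
  (hf.fderiv_of_isOpen hU (m := ∞) (by simp)).clm_apply contDiffOn_const

lemma contDiffOn_pdv (hU : IsOpen U) (hf : ContDiffOn ℝ ∞ f U) : ContDiffOn ℝ ∞ (pdv f) U :=
  (contDiffOn_fderiv_apply hU hf (0, 1)).congr fun _ hq =>
    pdv_eq_fderiv (hf.differentiableAt_of_isOpen hU hq)

lemma pdu_pdv_comm (hU : IsOpen U) (hf : ContDiffOn ℝ ∞ f U) (hp : p ∈ U) :
    pdu (pdv f) p = pdv (pdu f) p := by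
  have hd : DifferentiableAt ℝ (fderiv ℝ f) p :=
    ((hf.fderiv_of_isOpen hU (m := ∞) (by simp)).contDiffAt (hU.mem_nhds hp)).differentiableAt
      (by simp)
  have hsymm : IsSymmSndFDerivAt ℝ f p :=
    (hf.contDiffAt (hU.mem_nhds hp)).isSymmSndFDerivAt
      (by simpa using WithTop.coe_le_coe.2 (le_top : (2 : ℕ∞) ≤ ⊤))
  have hda (e : ℝ × ℝ) : DifferentiableAt ℝ (fun q => fderiv ℝ f q e) p :=
    (contDiffOn_fderiv_apply hU hf e).differentiableAt_of_isOpen hU hp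
  rw [pdu_congr hU (fun q hq => pdv_eq_fderiv (hf.differentiableAt_of_isOpen hU hq)) hp,
    pdv_congr hU (fun q hq => pdu_eq_fderiv (hf.differentiableAt_of_isOpen hU hq)) hp,
    pdu_eq_fderiv (hda _), pdv_eq_fderiv (hda _),
    fderiv_clm_apply hd (differentiableAt_const _), fderiv_clm_apply hd (differentiableAt_const _)]
  simpa using hsymm (1, 0) (0, 1)

end PartialDerivatives

section Geometry

/-- The weight `D/r²`. -/
def wgt (M : ℝ) (r : ℝ × ℝ → ℝ) : ℝ × ℝ → ℝ := fun p => Dfun M r p / (r p) ^ 2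

variable {M : ℝ} {U : Set (ℝ × ℝ)} {r f : ℝ × ℝ → ℝ} {p : ℝ × ℝ}

lemma Dfun_pos (hrp : 0 < r p) (hr2M : 2 * M < r p) : 0 < Dfun M r p :=
  sub_pos.2 ((div_lt_one hrp).2 hr2M)

lemma wgt_pos (hrp : 0 < r p) (hr2M : 2 * M < r p) : 0 < wgt M r p :=
  div_pos (Dfun_pos hrp hr2M) (by positivity)

lemma wgt_eq (hrp : 0 < r p) : wgt M r p = (r p)⁻¹ ^ 2 - 2 * M * (r p)⁻¹ ^ 3 := by
  unfold wgt Dfun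
  field_simp

lemma pdv_eq_wgt_mul_Pv (hrp : 0 < r p) (hr2M : 2 * M < r p) :
    pdv f p = wgt M r p * Pv M r f p := by
  have hD := (Dfun_pos hrp hr2M).ne'
  unfold wgt Pv
  field_simp

lemma hasDerivAt_inv_radius_fst (hd : DifferentiableAt ℝ r p) (hrp : 0 < r p)
    (hru : pdu r p = -(1 - 2 * M / r p)) :
    HasDerivAt (fun x => (r (x, p.2))⁻¹) (wgt M r p) p.1 := by
  refine ((hasDerivAt_pdu hd).fun_inv hrp.ne').congr_deriv ?_
  rw [hru, wgt, Dfun]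
  ring

lemma hasDerivAt_inv_radius_snd (hd : DifferentiableAt ℝ r p) (hrp : 0 < r p)
    (hrv : pdv r p = 1 - 2 * M / r p) :
    HasDerivAt (fun y => (r (p.1, y))⁻¹) (-wgt M r p) p.2 := by
  refine ((hasDerivAt_pdv hd).fun_inv hrp.ne').congr_deriv ?_
  rw [hrv, wgt, Dfun]
  ring

lemma contDiffOn_wgt (hr : ContDiffOn ℝ ∞ r U) (hpos : ∀ p ∈ U, 0 < r p) :
    ContDiffOn ℝ ∞ (wgt M r) U := by
  have hi : ContDiffOn ℝ ∞ (fun q => (r q)⁻¹) U := hr.inv fun q hq => (hpos q hq).ne'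
  exact ((hi.pow 2).sub (contDiffOn_const.mul (hi.pow 3))).congr fun q hq => wgt_eq (hpos q hq)

lemma contDiffOn_Pv (hU : IsOpen U) (hr : ContDiffOn ℝ ∞ r U) (hpos : ∀ p ∈ U, 0 < r p)
    (hr2M : ∀ p ∈ U, 2 * M < r p) (hf : ContDiffOn ℝ ∞ f U) :
    ContDiffOn ℝ ∞ (Pv M r f) U := by
  refine (((contDiffOn_wgt (M := M) hr hpos).inv
    fun q hq => (wgt_pos (hpos q hq) (hr2M q hq)).ne').mul (contDiffOn_pdv hU hf)).congr
    fun q hq => ?_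
  simp [Pv, wgt]

lemma contDiffOn_Pv_iterate (hU : IsOpen U) (hr : ContDiffOn ℝ ∞ r U)
    (hpos : ∀ p ∈ U, 0 < r p) (hr2M : ∀ p ∈ U, 2 * M < r p) (hf : ContDiffOn ℝ ∞ f U) (N : ℕ) :
    ContDiffOn ℝ ∞ ((Pv M r)^[N] f) U := by
  induction N with
  | zero => exact hf
  | succ N ih =>
    rw [Function.iterate_succ_apply']
    exact contDiffOn_Pv hU hr hpos hr2M ih

lemma hasDerivAt_wgt_fst (hU : IsOpen U) (hr : ContDiffOn ℝ ∞ r U) (hpos : ∀ p ∈ U, 0 < r p)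
    (hp : p ∈ U) (hru : pdu r p = -(1 - 2 * M / r p)) :
    HasDerivAt (fun x => wgt M r (x, p.2))
      (wgt M r p * (2 * (r p)⁻¹ - 6 * M * (r p)⁻¹ ^ 2)) p.1 := by
  have hy := hasDerivAt_inv_radius_fst (hr.differentiableAt_of_isOpen hU hp) (hpos p hp) hru
  have hd : pdu (wgt M r) p = wgt M r p * (2 * (r p)⁻¹ - 6 * M * (r p)⁻¹ ^ 2) := by
    rw [pdu_congr hU (fun q hq => wgt_eq (hpos q hq)) hp]
    refine (((hy.fun_pow 2).sub ((hy.fun_pow 3).const_mul (2 * M))).congr_deriv ?_).deriv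
    push_cast
    ring
  exact hd ▸ hasDerivAt_pdu ((contDiffOn_wgt hr hpos).differentiableAt_of_isOpen hU hp)

lemma pdu_wgt_zpow_mul (hU : IsOpen U) (hr : ContDiffOn ℝ ∞ r U) (hpos : ∀ p ∈ U, 0 < r p)
    (hr2M : ∀ p ∈ U, 2 * M < r p) (hp : p ∈ U) (hru : pdu r p = -(1 - 2 * M / r p))
    (hf : ContDiffOn ℝ ∞ f U) (m : ℤ) :
    pdu (fun q => wgt M r q ^ m * f q) p =
      wgt M r p ^ m * (m * (2 * (r p)⁻¹ - 6 * M * (r p)⁻¹ ^ 2) * f p + pdu f p) := by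
  have hw := wgt_pos (hpos p hp) (hr2M p hp)
  have h1 := (hasDerivAt_zpow m (wgt M r p) (Or.inl hw.ne')).comp p.1
    (hasDerivAt_wgt_fst hU hr hpos hp hru)
  have h2 := h1.mul (hasDerivAt_pdu (hf.differentiableAt_of_isOpen hU hp))
  refine (h2.congr_deriv ?_).deriv
  rw [zpow_sub_one₀ hw.ne', Function.comp_apply, Prod.mk.eta]
  field_simp

end Geometry

section Commutation

variable {M : ℝ} {U : Set (ℝ × ℝ)} {r α : ℝ × ℝ → ℝ} {s ℓ : ℤ}

lemma pdu_Pv_of_teukSol (hU : IsOpen U) (hr : ContDiffOn ℝ ∞ r U) (hpos : ∀ p ∈ U, 0 < r p)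
    (hr2M : ∀ p ∈ U, 2 * M < r p) (hru : ∀ p ∈ U, pdu r p = -(1 - 2 * M / r p))
    (hα : ContDiffOn ℝ ∞ α U) (hTeuk : TeukSol M r U s ℓ α) {p : ℝ × ℝ} (hp : p ∈ U) :
    pdu (Pv M r α) p =
      -(s + 1) * (2 * (r p)⁻¹ - 6 * M * (r p)⁻¹ ^ 2) * Pv M r α p
        + (-(ℓ - s) * (ℓ + s + 1) - 2 * M * (r p)⁻¹ * ((1 + s) * (1 + 2 * s))) * α p := by
  have hw := wgt_pos (hpos p hp) (hr2M p hp)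
  have hT := hTeuk p hp
  have hpow (q) (hq : q ∈ U) (m : ℤ) :
      (r q) ^ (-(2 * m)) * (Dfun M r q) ^ m = wgt M r q ^ m := by
    rw [wgt, div_zpow, zpow_neg, zpow_mul, zpow_ofNat]
    ring
  rw [pdu_congr hU (g := fun q => wgt M r q ^ (s + 1) * Pv M r α q) _ hp,
    pdu_wgt_zpow_mul hU hr hpos hr2M hp (hru p hp) (contDiffOn_Pv hU hr hpos hr2M hα)] at hT
  · have e1 : (r p) ^ (-2 - 2 * s) = (r p) ^ (-(2 * (s + 1))) := by ring_nf
    have e2 : (r p) ^ (-3 - 2 * s) = (r p) ^ (-(2 * (s + 1))) * (r p)⁻¹ := by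
      rw [← zpow_sub_one₀ (hpos p hp).ne']
      ring_nf
    rw [e1, e2] at hT
    have h3 := hpow p hp (s + 1)
    have hz : wgt M r p ^ (s + 1) ≠ 0 := (zpow_pos hw _).ne'
    apply mul_left_cancel₀ hz
    push_cast at hT
    linear_combination hT + (-(ℓ - s) * (ℓ + s + 1) * α p
      - 2 * M * (r p)⁻¹ * ((1 + s) * (1 + 2 * s)) * α p) * h3
  · intro q hq
    have hwq := wgt_pos (hpos q hq) (hr2M q hq)
    rw [hpow q hq, pdv_eq_wgt_mul_Pv (hpos q hq) (hr2M q hq), zpow_add_one₀ hwq.ne', mul_assoc]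

lemma pdu_Pv_iterate_of_teukSol (hU : IsOpen U) (hr : ContDiffOn ℝ ∞ r U)
    (hpos : ∀ p ∈ U, 0 < r p) (hr2M : ∀ p ∈ U, 2 * M < r p)
    (hru : ∀ p ∈ U, pdu r p = -(1 - 2 * M / r p)) (hrv : ∀ p ∈ U, pdv r p = 1 - 2 * M / r p)
    (hα : ContDiffOn ℝ ∞ α U) (hTeuk : TeukSol M r U s ℓ α) (N : ℕ) :
    ∀ p ∈ U, pdu ((Pv M r)^[N + 1] α) p =
      -(s + 1 + N) * (2 * (r p)⁻¹ - 6 * M * (r p)⁻¹ ^ 2) * (Pv M r)^[N + 1] α p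
        + (-(ℓ - s) * (ℓ + s + 1) + N * (N + 1 + 2 * s)
            - 2 * M * (r p)⁻¹ * ((1 + s) * (1 + 2 * s) + 3 * N * (N + 1 + 2 * s)))
          * (Pv M r)^[N] α p
        + 2 * M * (N * (N + s) * (N + 2 * s)) * (Pv M r)^[N - 1] α p := by
  induction N with
  | zero =>
    intro p hp
    simpa using pdu_Pv_of_teukSol hU hr hpos hr2M hru hα hTeuk hp
  | succ N ih =>
    intro p hp
    have hw := wgt_pos (hpos p hp) (hr2M p hp)
    have hsm (n : ℕ) : ContDiffOn ℝ ∞ ((Pv M r)^[n] α) U :=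
      contDiffOn_Pv_iterate hU hr hpos hr2M hα n
    have hv (n : ℕ) (q) (hq : q ∈ U) :
        pdv ((Pv M r)^[n] α) q = wgt M r q * (Pv M r)^[n + 1] α q := by
      rw [Function.iterate_succ_apply']
      exact pdv_eq_wgt_mul_Pv (hpos q hq) (hr2M q hq)
    have hda (n : ℕ) := hv n p hp ▸ hasDerivAt_pdv ((hsm n).differentiableAt_of_isOpen hU hp)
    have hy := hasDerivAt_inv_radius_snd (hr.differentiableAt_of_isOpen hU hp) (hpos p hp) (hrv p hp)
    have hcomm := pdu_pdv_comm hU (hsm (N + 1)) hp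
    have hleft : pdu (pdv ((Pv M r)^[N + 1] α)) p = wgt M r p *
        ((2 * (r p)⁻¹ - 6 * M * (r p)⁻¹ ^ 2) * (Pv M r)^[N + 2] α p
          + pdu ((Pv M r)^[N + 2] α) p) := by
      rw [pdu_congr hU (hv (N + 1)) hp]
      simpa using pdu_wgt_zpow_mul hU hr hpos hr2M hp (hru p hp) (hsm (N + 2)) 1
    have hlast : HasDerivAt
        (fun y => 2 * M * (N * (N + s) * (N + 2 * s)) * (Pv M r)^[N - 1] α (p.1, y))
        (2 * M * (N * (N + s) * (N + 2 * s)) * (wgt M r p * (Pv M r)^[N] α p)) p.2 := by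
      rcases N with _ | N
      · simpa using hasDerivAt_const p.2 (0 : ℝ)
      · exact (hda N).const_mul _
    have hright := (((((hy.const_mul 2).fun_sub ((hy.fun_pow 2).const_mul (6 * M))).const_mul
      (-(s + 1 + N) : ℝ)).fun_mul (hda (N + 1))).fun_add
      (((hy.const_mul (2 * M)).mul_const
        ((1 + s) * (1 + 2 * s) + 3 * N * (N + 1 + 2 * s) : ℝ)).const_sub
        (-(ℓ - s) * (ℓ + s + 1) + N * (N + 1 + 2 * s) : ℝ) |>.fun_mul (hda N))).fun_add hlast
    have hright' := hright.deriv
    rw [hleft, pdv_congr hU ih hp] at hcomm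
    have hcomm' := hcomm.trans hright'
    apply mul_left_cancel₀ hw.ne'
    push_cast at hcomm' ⊢
    linear_combination hcomm'

end Commutation

section Coefficients

lemma zfactR_pos (n : ℤ) : 0 < zfactR n := by
  unfold zfactR
  exact_mod_cast Nat.factorial_pos _

lemma zfactR_eq_mul {n : ℤ} (hn : 1 ≤ n) : zfactR n = n * zfactR (n - 1) := by
  obtain ⟨m, rfl⟩ : ∃ m : ℕ, n = m + 1 := ⟨(n - 1).toNat, by omega⟩
  have h : ((m : ℤ) + 1).toNat = m + 1 := by omega
  simp [zfactR, h, Nat.factorial_succ]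

lemma coefficient_recurrence {s ℓ : ℤ} (hsl : |s| ≤ ℓ) {x : ℕ → ℝ}
    (hx : ∀ i : ℕ, x i =
      if (i : ℤ) ≤ ℓ - |s| then
        1 / (Nat.factorial i : ℝ) * (zfactR (2 * ℓ - (i : ℤ)) / zfactR (2 * ℓ)) *
          (zfactR (ℓ - s) * zfactR ℓ * zfactR (ℓ + s)) /
          (zfactR (ℓ - s - (i : ℤ)) * zfactR (ℓ - (i : ℤ)) * zfactR (ℓ + s - (i : ℤ)))
      else 0) {k : ℕ} (hk : (k : ℤ) ≤ ℓ - |s|) :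
    ((k : ℝ) + 1) * (2 * ℓ - k) * x (k + 1) =
      (ℓ - s - k) * (ℓ - k) * (ℓ + s - k) * x k := by
  have hs1 := le_abs_self s
  have hs2 := neg_abs_le s
  rcases hk.lt_or_eq with hlt | heq
  · have hk1 : ((k + 1 : ℕ) : ℤ) ≤ ℓ - |s| := by push_cast; omega
    rw [hx, hx, if_pos hk, if_pos hk1, Nat.factorial_succ,
      zfactR_eq_mul (n := 2 * ℓ - k) (by omega), zfactR_eq_mul (n := ℓ - s - k) (by omega),
      zfactR_eq_mul (n := ℓ - k) (by omega), zfactR_eq_mul (n := ℓ + s - k) (by omega)]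
    push_cast
    simp only [← sub_sub]
    have h1 : ((ℓ : ℝ) - s - k) ≠ 0 := by
      exact_mod_cast (by omega : (ℓ - s - k : ℤ) ≠ 0)
    have h2 : ((ℓ : ℝ) - k) ≠ 0 := by
      exact_mod_cast (by omega : (ℓ - k : ℤ) ≠ 0)
    have h3 : ((ℓ : ℝ) + s - k) ≠ 0 := by
      exact_mod_cast (by omega : (ℓ + s - k : ℤ) ≠ 0)
    have p1 := (zfactR_pos (2 * ℓ)).ne'
    have p2 := (zfactR_pos (ℓ - s - k - 1)).ne'
    have p3 := (zfactR_pos (ℓ - k - 1)).ne'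
    have p4 := (zfactR_pos (ℓ + s - k - 1)).ne'
    have p5 : (k.factorial : ℝ) ≠ 0 := by exact_mod_cast k.factorial_ne_zero
    have p6 : (k : ℝ) + 1 ≠ 0 := by positivity
    field_simp
  · have hk1 : ¬ ((k + 1 : ℕ) : ℤ) ≤ ℓ - |s| := by push_cast; omega
    have hz : (ℓ - s - k) * (ℓ + s - k) = 0 := by
      rcases abs_choice s with h | h
      · rw [show ℓ - s - k = 0 by omega, zero_mul]
      · rw [show ℓ + s - k = 0 by omega, mul_zero]
    have hz' : ((ℓ : ℝ) - s - k) * (ℓ + s - k) = 0 := by exact_mod_cast hz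
    rw [hx (k + 1), if_neg hk1]
    linear_combination (-(ℓ - k) * x k) * hz'

end Coefficients

/-- Equation (8.14): the approximate conservation law satisfied by `A^{[s]}_ℓ`, in scalar
fixed-angular-mode form.  Every term on the right-hand side carries a factor `2M/r`. -/
theorem approximate_conservation_law
    (M : ℝ) (hM : 0 ≤ M)
    (U : Set (ℝ × ℝ)) (hUopen : IsOpen U)
    (r : ℝ × ℝ → ℝ) (hr : ContDiffOn ℝ ∞ r U)
    (hr2M : ∀ p ∈ U, 2 * M < r p)
    (hru : ∀ p ∈ U, pdu r p = -(1 - 2 * M / r p))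
    (hrv : ∀ p ∈ U, pdv r p = 1 - 2 * M / r p)
    (s ℓ : ℤ) (hsl : |s| ≤ ℓ)
    (α : ℝ × ℝ → ℝ) (hα : ContDiffOn ℝ ∞ α U)
    (hTeuk : TeukSol M r U s ℓ α)
    (x : ℕ → ℝ)
    (hx : ∀ i : ℕ, x i =
      if (i : ℤ) ≤ ℓ - |s| then
        1 / (Nat.factorial i : ℝ) * (zfactR (2 * ℓ - (i : ℤ)) / zfactR (2 * ℓ)) *
          (zfactR (ℓ - s) * zfactR ℓ * zfactR (ℓ + s)) /
          (zfactR (ℓ - s - (i : ℤ)) * zfactR (ℓ - (i : ℤ)) * zfactR (ℓ + s - (i : ℤ)))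
      else 0)
    (A : ℝ × ℝ → ℝ)
    (hA : A = fun p => ∑ i ∈ Finset.range ((ℓ - |s|).toNat + 1),
      x i * (2 * M) ^ i * ((Pv M r)^[(ℓ - s - (i : ℤ)).toNat] α) p) :
    ∀ p ∈ U,
      pdu (fun q => (Dfun M r q / (r q) ^ 2) ^ ℓ * pdv A q) p =
        ∑ k ∈ Finset.range ((ℓ - |s|).toNat + 1),
          (2 * ((k : ℝ) + 1) * x (k + 1) * (2 * M / r p) * (1 - 3 * M / r p)
              - x k * (2 * M / r p) *
                (((1 + s) * (1 + 2 * s)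
                    + 3 * (ℓ - s - (k : ℤ)) * ((ℓ - s - (k : ℤ)) + 1 + 2 * s) : ℤ) : ℝ)) *
            (Dfun M r p / (r p) ^ 2) ^ (ℓ + 1) * (2 * M) ^ k *
            ((Pv M r)^[(ℓ - s - (k : ℤ)).toNat] α) p := by
  intro p hp
  have hpos : ∀ q ∈ U, 0 < r q := fun q hq => by linarith [hr2M q hq]
  have hsm (n : ℕ) : ContDiffOn ℝ ∞ ((Pv M r)^[n] α) U :=
    contDiffOn_Pv_iterate hUopen hr hpos hr2M hα n
  set K := (ℓ - |s|).toNat with hK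
  have hKcast : (K : ℤ) = ℓ - |s| := by omega
  have hs1 := le_abs_self s
  have hs2 := neg_abs_le s
  set n : ℕ → ℕ := fun i => (ℓ - s - (i : ℤ)).toNat with hn
  have hB : ContDiffOn ℝ ∞ (fun q => ∑ i ∈ Finset.range (K + 1),
      x i * (2 * M) ^ i * (Pv M r)^[n i + 1] α q) U :=
    ContDiffOn.sum fun i _ => contDiffOn_const.mul (hsm _)
  have hflux : ∀ q ∈ U, (Dfun M r q / (r q) ^ 2) ^ ℓ * pdv A q =
      wgt M r q ^ (ℓ + 1) * ∑ i ∈ Finset.range (K + 1),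
        x i * (2 * M) ^ i * (Pv M r)^[n i + 1] α q := by
    intro q hq
    have hA' : pdv A q = ∑ i ∈ Finset.range (K + 1),
        x i * (2 * M) ^ i * pdv ((Pv M r)^[n i] α) q := by
      rw [hA]
      exact (HasDerivAt.fun_sum fun i _ => (hasDerivAt_pdv
        ((hsm (n i)).differentiableAt_of_isOpen hUopen hq)).const_mul _).deriv
    rw [hA', zpow_add_one₀ (wgt_pos (hpos q hq) (hr2M q hq)).ne', mul_assoc, Finset.mul_sum _ _
      (wgt M r q)]
    congr 1
    refine Finset.sum_congr rfl fun i _ => ?_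
    rw [pdv_eq_wgt_mul_Pv (hpos q hq) (hr2M q hq), Function.iterate_succ_apply']
    ring
  have hpduB : pdu (fun q => ∑ i ∈ Finset.range (K + 1),
        x i * (2 * M) ^ i * (Pv M r)^[n i + 1] α q) p =
      ∑ i ∈ Finset.range (K + 1), x i * (2 * M) ^ i * pdu ((Pv M r)^[n i + 1] α) p :=
    (HasDerivAt.fun_sum fun i _ => (hasDerivAt_pdu
      ((hsm (n i + 1)).differentiableAt_of_isOpen hUopen hp)).const_mul _).deriv
  rw [pdu_congr hUopen hflux hp,
    pdu_wgt_zpow_mul hUopen hr hpos hr2M hp (hru p hp) hB, hpduB, Finset.mul_sum,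
    ← Finset.sum_add_distrib, Finset.mul_sum, ← sub_eq_zero, ← Finset.sum_sub_distrib]
  set H : ℕ → ℝ := fun i => i * (2 * ℓ + 1 - i) * x i * (2 * M) ^ i * wgt M r p ^ (ℓ + 1)
      * (Pv M r)^[n i] α p
    - i * x i * (2 * M) ^ i * wgt M r p ^ (ℓ + 1) * (2 * (r p)⁻¹ - 6 * M * (r p)⁻¹ ^ 2)
      * (Pv M r)^[n (i - 1)] α p with hH
  have htel : ∑ i ∈ Finset.range (K + 1), (H (i + 1) - H i) = 0 := by
    rw [Finset.sum_range_sub]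
    have hxK : x (K + 1) = 0 := by
      rw [hx, if_neg (by push_cast; omega)]
    simp [hH, hxK]
  rw [← htel]
  refine Finset.sum_congr rfl fun i hi => ?_
  have hiK : (i : ℤ) ≤ ℓ - |s| := by
    have := Finset.mem_range.1 hi
    omega
  have hnZ : ((n i : ℕ) : ℤ) = ℓ - s - i := by
    simp only [hn]
    omega
  have hnR : (n i : ℝ) = ℓ - s - i := by exact_mod_cast hnZ
  have hrec := coefficient_recurrence hsl hx hiK
  have hnsucc : n (i + 1) = n i - 1 := by
    simp only [hn]
    omega
  have hprev : (i : ℝ) * (Pv M r)^[n i + 1] α p = i * (Pv M r)^[n (i - 1)] α p := by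
    rcases i with _ | i
    · simp
    · have : n (i + 1) + 1 = n i := by
        simp only [hn]
        omega
      rw [this, Nat.add_sub_cancel]
  rw [pdu_Pv_iterate_of_teukSol hUopen hr hpos hr2M hru hrv hα hTeuk (n i) p hp]
  simp only [hH, hnsucc, Nat.add_sub_cancel, hnR]
  change _ - _ * wgt M r p ^ (ℓ + 1) * _ * (Pv M r)^[n i] α p = _
  push_cast
  linear_combination (x i * (2 * M) ^ i * wgt M r p ^ (ℓ + 1)
      * (2 * (r p)⁻¹ - 6 * M * (r p)⁻¹ ^ 2)) * hprev
    - (2 * M) ^ (i + 1) * wgt M r p ^ (ℓ + 1) * (Pv M r)^[n i - 1] α p * hrec
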